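/- For m ≥ 2, a multiplication operator M_u on L²(μ) is m-isometric if and only if it is 2-isometric; and M_u is quasi-m-isometric if and only if it is quasi-2-isometric. -/

import Mathlib

open ContinuousLinearMap Finset MeasureTheory

section CStarAlgebra

variable {E : Type*} [NormedRing E] [StarRing E] [CStarRing E]

theorem IsSelfAdjoint.eq_zero_of_pow {a : E} (ha : IsSelfAdjoint a) {n : ℕ}
    (h : a ^ n = 0) : a = 0 := by
  have h₂ : a ^ 2 ^ n = 0 := pow_eq_zero_of_le Nat.lt_two_pow_self.le h
  have h₃ := ha.nnnorm_pow_two_pow n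
  rw [h₂, nnnorm_zero] at h₃
  exact nnnorm_eq_zero.mp (eq_zero_of_pow_eq_zero h₃.symm)

theorem IsSelfAdjoint.sub_one_pow_eq_zero_iff {a : E} (ha : IsSelfAdjoint a) {n : ℕ}
    (hn : n ≠ 0) : (a - 1) ^ n = 0 ↔ a - 1 = 0 :=
  ⟨(ha.sub (.one E)).eq_zero_of_pow, fun h => by rw [h, zero_pow hn]⟩

theorem IsSelfAdjoint.mul_sub_one_pow_eq_zero_iff {a : E} (ha : IsSelfAdjoint a) {n : ℕ}
    (hn : n ≠ 0) : a * (a - 1) ^ n = 0 ↔ a * (a - 1) = 0 := by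
  obtain ⟨n, rfl⟩ := Nat.exists_eq_succ_of_ne_zero hn
  have hcomm : Commute a (a - 1) := (Commute.refl a).sub_right (.one_right a)
  refine ⟨fun h => ?_, fun h => by rw [pow_succ', ← mul_assoc, h, zero_mul]⟩
  refine ((ha.commute_iff (ha.sub (.one E))).mp hcomm).eq_zero_of_pow (n := n + 1) ?_
  rw [hcomm.mul_pow, pow_succ, mul_assoc, h, mul_zero]

end CStarAlgebra

section Defect

variable {E : Type*} [Ring E] [Algebra ℂ E] {a b : E}

theorem Commute.sum_smul_pow_mul_pow (h : Commute b a) (n : ℕ) :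
    ∑ k ∈ range (n + 1), ((-1 : ℂ) ^ (n - k) * (n.choose k : ℂ)) • (b ^ k * a ^ k) =
      (b * a - 1) ^ n := by
  rw [sub_eq_add_neg, (Commute.neg_one_right (b * a)).add_pow]
  refine sum_congr rfl fun k _ => ?_
  rw [← h.mul_pow, Algebra.smul_def, mul_assoc, Algebra.commutes]
  simp

theorem Commute.sum_smul_pow_succ_mul_pow_succ (h : Commute b a) (n : ℕ) :
    ∑ k ∈ range (n + 1),
        ((-1 : ℂ) ^ (n - k) * (n.choose k : ℂ)) • (b ^ (k + 1) * a ^ (k + 1)) =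
      b * a * (b * a - 1) ^ n := by
  rw [← h.sum_smul_pow_mul_pow, mul_sum]
  refine sum_congr rfl fun k _ => ?_
  rw [mul_smul_comm, ← h.mul_pow, ← h.mul_pow, pow_succ']

end Defect

section Multiplication

variable {X : Type*} [MeasurableSpace X] {μ : Measure X} {u : X → ℂ}
  {M : Lp ℂ 2 μ →L[ℂ] Lp ℂ 2 μ}

/-- No measurability of `u` is needed: that of `u * f` suffices. -/
theorem memLp_star_mul (hM : ∀ f : Lp ℂ 2 μ, ⇑(M f) =ᵐ[μ] fun x => u x * f x) (f : Lp ℂ 2 μ) :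
    MemLp (fun x => star (u x) * f x) 2 μ := by
  have hf : Measurable f := (Lp.stronglyMeasurable f).measurable
  have hMf : Measurable (M f) := (Lp.stronglyMeasurable (M f)).measurable
  have hmeas : AEStronglyMeasurable (fun x => star (u x) * f x) μ := by
    have hquot : Measurable fun x => star (M f x) * (f x / star (f x)) := by fun_prop
    refine hquot.aestronglyMeasurable.congr ?_
    filter_upwards [hM f] with x hx
    rw [hx]
    by_cases h : f x = 0
    · simp [h]
    · have h' : star (f x) ≠ 0 := star_ne_zero.mpr h
      rw [star_mul']
      field_simp
  refine (Lp.memLp (M f)).congr_norm hmeas ?_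
  filter_upwards [hM f] with x hx
  simp [hx]

theorem adjoint_mul_ae_eq (hM : ∀ f : Lp ℂ 2 μ, ⇑(M f) =ᵐ[μ] fun x => u x * f x)
    (f : Lp ℂ 2 μ) : ⇑(adjoint M f) =ᵐ[μ] fun x => star (u x) * f x := by
  have heq : adjoint M f = (memLp_star_mul hM f).toLp _ := by
    refine ext_inner_right ℂ fun g => ?_
    rw [adjoint_inner_left, L2.inner_def, L2.inner_def]
    refine integral_congr_ae ?_
    filter_upwards [hM g, (memLp_star_mul hM f).coeFn_toLp] with x hx hx'
    rw [hx, hx']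
    simp only [RCLike.inner_apply, map_mul, RCLike.star_def, RCLike.conj_conj]
    ring
  rw [heq]
  exact (memLp_star_mul hM f).coeFn_toLp

theorem commute_adjoint_mul (hM : ∀ f : Lp ℂ 2 μ, ⇑(M f) =ᵐ[μ] fun x => u x * f x) :
    Commute (adjoint M) M := by
  refine ContinuousLinearMap.ext fun f => Lp.ext ?_
  filter_upwards [hM f, adjoint_mul_ae_eq hM f, adjoint_mul_ae_eq hM (M f),
    hM (adjoint M f)] with x h₁ h₂ h₃ h₄
  rw [ContinuousLinearMap.mul_def, ContinuousLinearMap.mul_def, comp_apply, comp_apply,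
    h₃, h₄, h₁, h₂]
  ring

end Multiplication

/-- For m ≥ 2, the multiplication operator M_u on L²(μ) is m-isometric iff it is
2-isometric, and quasi-m-isometric iff quasi-2-isometric. -/
theorem stmt_9 {X : Type*} [MeasurableSpace X] (μ : Measure X) [SigmaFinite μ]
    (u : X → ℂ) (M : Lp ℂ 2 μ →L[ℂ] Lp ℂ 2 μ)
    (hM : ∀ f : Lp ℂ 2 μ, ⇑(M f) =ᵐ[μ] fun x => u x * f x)
    (m : ℕ) (hm : 2 ≤ m) :
    ((∑ k ∈ range (m + 1),
        ((-1 : ℂ) ^ (m - k) * (m.choose k : ℂ)) • ((adjoint M) ^ k * M ^ k) = 0)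
      ↔ (∑ k ∈ range 3,
        ((-1 : ℂ) ^ (2 - k) * (Nat.choose 2 k : ℂ)) • ((adjoint M) ^ k * M ^ k) = 0)) ∧
    ((∑ k ∈ range (m + 1),
        ((-1 : ℂ) ^ (m - k) * (m.choose k : ℂ)) •
          ((adjoint M) ^ (k + 1) * M ^ (k + 1)) = 0)
      ↔ (∑ k ∈ range 3,
        ((-1 : ℂ) ^ (2 - k) * (Nat.choose 2 k : ℂ)) •
          ((adjoint M) ^ (k + 1) * M ^ (k + 1)) = 0)) := by
  have hcomm := commute_adjoint_mul hM
  have hself : IsSelfAdjoint (adjoint M * M) := IsSelfAdjoint.star_mul_self M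
  have hm₀ : m ≠ 0 := by omega
  rw [hcomm.sum_smul_pow_mul_pow, hcomm.sum_smul_pow_mul_pow 2,
    hcomm.sum_smul_pow_succ_mul_pow_succ, hcomm.sum_smul_pow_succ_mul_pow_succ 2,
    hself.sub_one_pow_eq_zero_iff hm₀, hself.sub_one_pow_eq_zero_iff two_ne_zero,
    hself.mul_sub_one_pow_eq_zero_iff hm₀, hself.mul_sub_one_pow_eq_zero_iff two_ne_zero]
  exact ⟨Iff.rfl, Iff.rfl⟩
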